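/- Let n ≥ 1, K > 0, let x₁,…,x_m ∈ L^n_K, let ω₁,…,ω_m be nonnegative reals with Σᵢωᵢ > 0, and set a = Σᵢ₌₁^m ωᵢxᵢ. Then the Lorentzian centroid μ_L = √K · a / |‖a‖_L| lies on L^n_K and is the unique minimizer over L^n_K of the weighted sum of squared Lorentzian distances μ ↦ Σᵢ₌₁^m ωᵢ d²_L(xᵢ, μ): for every μ ∈ L^n_K with μ ≠ μ_L, Σᵢ ωᵢ d²_L(xᵢ, μ_L) < Σᵢ ωᵢ d²_L(xᵢ, μ). -/

import Mathlib

open Finset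

/-- The Lorentzian scalar product on `ℝ^{n+1}` (coordinates indexed `0, …, n`):
`⟨x,y⟩_L = −x₀y₀ + ∑_{i=1}^n xᵢyᵢ`. -/
def lorentzInner {n : ℕ} (x y : Fin (n + 1) → ℝ) : ℝ :=
  -(x 0 * y 0) + ∑ i : Fin n, x i.succ * y i.succ

/-- The squared Lorentzian distance for curvature parameter `K`:
`d²_L(x,y) = −2K − 2⟨x,y⟩_L`. -/
def lorentzDistSq {n : ℕ} (K : ℝ) (x y : Fin (n + 1) → ℝ) : ℝ :=
  -2 * K - 2 * lorentzInner x y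

theorem lorentzInner_comm {n : ℕ} (x y : Fin (n + 1) → ℝ) :
    lorentzInner x y = lorentzInner y x := by
  simp only [lorentzInner, mul_comm]

theorem lorentzInner_smul_left {n : ℕ} (c : ℝ) (x y : Fin (n + 1) → ℝ) :
    lorentzInner (c • x) y = c * lorentzInner x y := by
  simp only [lorentzInner, Pi.smul_apply, smul_eq_mul, mul_add, mul_neg, mul_sum, mul_assoc]

theorem lorentzInner_add_left {n : ℕ} (x y z : Fin (n + 1) → ℝ) :
    lorentzInner (x + y) z = lorentzInner x z + lorentzInner y z := by
  simp only [lorentzInner, Pi.add_apply, add_mul, sum_add_distrib]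
  ring

theorem lorentzInner_sum_smul_left {n : ℕ} {ι : Type*} (s : Finset ι) (ω : ι → ℝ)
    (x : ι → Fin (n + 1) → ℝ) (y : Fin (n + 1) → ℝ) :
    lorentzInner (∑ i ∈ s, ω i • x i) y = ∑ i ∈ s, ω i * lorentzInner (x i) y := by
  classical
  induction s using Finset.induction_on with
  | empty => simp [lorentzInner]
  | insert i s hi ih =>
    rw [sum_insert hi, sum_insert hi, lorentzInner_add_left, lorentzInner_smul_left, ih]

/-- Two future-directed time-like vectors have negative Lorentzian scalar product. -/
theorem lorentzInner_neg_of_timelike {n : ℕ} {x y : Fin (n + 1) → ℝ}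
    (hx : lorentzInner x x < 0) (hy : lorentzInner y y < 0) (hx0 : 0 < x 0) (hy0 : 0 < y 0) :
    lorentzInner x y < 0 := by
  have hcs := sum_mul_sq_le_sq_mul_sq univ (fun i : Fin n => x i.succ) (fun i => y i.succ)
  simp only [lorentzInner, ← pow_two] at hx hy ⊢
  have hX : 0 ≤ ∑ i : Fin n, x i.succ ^ 2 := sum_nonneg fun i _ => sq_nonneg _
  have hY : 0 ≤ ∑ i : Fin n, y i.succ ^ 2 := sum_nonneg fun i _ => sq_nonneg _
  have hlt : (∑ i : Fin n, x i.succ * y i.succ) ^ 2 < (x 0 * y 0) ^ 2 := by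
    rw [mul_pow]
    exact hcs.trans_lt (mul_lt_mul'' (by linarith) (by linarith) hX hY)
  linarith [lt_of_pow_lt_pow_left₀ 2 (mul_pos hx0 hy0).le hlt]

/-- The strict reverse Cauchy–Schwarz inequality for distinct points of the hyperboloid. -/
theorem lorentzInner_lt_neg_of_ne {n : ℕ} {K : ℝ} (hK : 0 < K) {x y : Fin (n + 1) → ℝ}
    (hx : lorentzInner x x = -K) (hy : lorentzInner y y = -K) (hx0 : 0 < x 0) (hy0 : 0 < y 0)
    (hne : x ≠ y) : lorentzInner x y < -K := by
  have hneg := lorentzInner_neg_of_timelike (by linarith) (by linarith) hx0 hy0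
  have hcs := sum_mul_sq_le_sq_mul_sq univ
    (fun i : Fin n => x i.succ - y i.succ) (fun i => x i.succ + y i.succ)
  have hD : 0 < ∑ i : Fin n, (x i.succ - y i.succ) ^ 2 := by
    refine (sum_nonneg fun i _ => sq_nonneg _).lt_of_ne' fun h => hne ?_
    have hs : ∀ i : Fin n, x i.succ = y i.succ := fun i => by
      have := (sum_eq_zero_iff_of_nonneg fun i _ => sq_nonneg _).1 h i (mem_univ i)
      exact sub_eq_zero.1 (pow_eq_zero_iff two_ne_zero |>.1 this)
    have h0 : x 0 = y 0 := by
      simp only [lorentzInner, hs] at hx hy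
      nlinarith
    funext i
    exact Fin.cases h0 hs i
  have hsub : ∑ i : Fin n, (x i.succ - y i.succ) ^ 2 = ∑ i : Fin n, x i.succ * x i.succ
      + ∑ i : Fin n, y i.succ * y i.succ - 2 * ∑ i : Fin n, x i.succ * y i.succ := by
    rw [mul_sum, ← sum_add_distrib, ← sum_sub_distrib]
    exact sum_congr rfl fun i _ => by ring
  have hadd : ∑ i : Fin n, (x i.succ + y i.succ) ^ 2 = ∑ i : Fin n, x i.succ * x i.succ
      + ∑ i : Fin n, y i.succ * y i.succ + 2 * ∑ i : Fin n, x i.succ * y i.succ := by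
    rw [mul_sum, ← sum_add_distrib, ← sum_add_distrib]
    exact sum_congr rfl fun i _ => by ring
  have hmul : ∑ i : Fin n, (x i.succ - y i.succ) * (x i.succ + y i.succ)
      = ∑ i : Fin n, x i.succ * x i.succ - ∑ i : Fin n, y i.succ * y i.succ := by
    rw [← sum_sub_distrib]
    exact sum_congr rfl fun i _ => by ring
  simp only [lorentzInner] at hx hy hneg ⊢
  have hA : ∑ i : Fin n, (x i.succ + y i.succ) ^ 2 < (x 0 + y 0) ^ 2 := by
    rw [hadd]
    nlinarith
  have hB : ∑ i : Fin n, (x i.succ - y i.succ) * (x i.succ + y i.succ)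
      = (x 0 - y 0) * (x 0 + y 0) := by
    rw [hmul]
    linarith
  have hlt : (x 0 - y 0) ^ 2 < ∑ i : Fin n, (x i.succ - y i.succ) ^ 2 := by
    refine lt_of_mul_lt_mul_right ?_ (sq_nonneg (x 0 + y 0))
    rw [← mul_pow, ← hB]
    exact hcs.trans_lt (mul_lt_mul_of_pos_left hA hD)
  rw [hsub] at hlt
  linarith

theorem sum_mul_pos_of_sum_pos {ι : Type*} {s : Finset ι} {ω f : ι → ℝ}
    (hω : ∀ i ∈ s, 0 ≤ ω i) (hsum : 0 < ∑ i ∈ s, ω i) (hf : ∀ i ∈ s, 0 < f i) :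
    0 < ∑ i ∈ s, ω i * f i := by
  obtain ⟨i, hi, hpos⟩ := exists_lt_of_sum_lt (s := s) (f := fun _ => 0) (g := ω) (by simpa)
  exact sum_pos' (fun j hj => mul_nonneg (hω j hj) (hf j hj).le) ⟨i, hi, mul_pos hpos (hf i hi)⟩

/-- A nontrivial nonnegative combination of future-directed time-like vectors is time-like. -/
theorem lorentzInner_sum_smul_self_neg {n : ℕ} {ι : Type*} {s : Finset ι} {ω : ι → ℝ}
    {x : ι → Fin (n + 1) → ℝ} (hω : ∀ i ∈ s, 0 ≤ ω i) (hsum : 0 < ∑ i ∈ s, ω i)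
    (hx : ∀ i ∈ s, lorentzInner (x i) (x i) < 0) (hx0 : ∀ i ∈ s, 0 < x i 0) :
    lorentzInner (∑ i ∈ s, ω i • x i) (∑ i ∈ s, ω i • x i) < 0 := by
  have hright : ∀ i ∈ s, 0 < -lorentzInner (x i) (∑ j ∈ s, ω j • x j) := fun i hi => by
    rw [lorentzInner_comm, lorentzInner_sum_smul_left, ← sum_neg_distrib]
    simp only [← mul_neg]
    exact sum_mul_pos_of_sum_pos hω hsum fun j hj =>
      neg_pos.2 (lorentzInner_neg_of_timelike (hx j hj) (hx i hi) (hx0 j hj) (hx0 i hi))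
  have h := sum_mul_pos_of_sum_pos hω hsum hright
  simp only [mul_neg, sum_neg_distrib] at h
  rw [lorentzInner_sum_smul_left]
  linarith

/-- The weighted sum of squared distances depends on the points only through their weighted sum. -/
theorem sum_mul_lorentzDistSq {n : ℕ} {ι : Type*} (s : Finset ι) (K : ℝ) (ω : ι → ℝ)
    (x : ι → Fin (n + 1) → ℝ) (y : Fin (n + 1) → ℝ) :
    ∑ i ∈ s, ω i * lorentzDistSq K (x i) y
      = -2 * K * ∑ i ∈ s, ω i - 2 * lorentzInner (∑ i ∈ s, ω i • x i) y := by
  rw [lorentzInner_sum_smul_left, mul_sum, mul_sum, ← sum_sub_distrib]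
  exact sum_congr rfl fun i _ => by rw [lorentzDistSq]; ring

/-- **The Lorentzian centroid is the unique minimizer of the weighted sum of squared
Lorentzian distances over the hyperboloid.**
For points `x i` on `L^n_K` (`K > 0`), nonnegative weights `ω` with `∑ ω i > 0`, and
`a = ∑ ω i • x i`, the centroid `μL = √K • a / |‖a‖_L|` lies on `L^n_K` and for every
`μ ∈ L^n_K` with `μ ≠ μL` one has
`∑ ω i d²_L(x i, μL) < ∑ ω i d²_L(x i, μ)`. -/
theorem lorentz_centroid_unique_minimizer {n : ℕ} (hn : 1 ≤ n) {K : ℝ} (hK : 0 < K)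
    {m : ℕ} (x : Fin m → (Fin (n + 1) → ℝ)) (ω : Fin m → ℝ)
    (hx : ∀ i, lorentzInner (x i) (x i) = -K) (hx0 : ∀ i, 0 < x i 0)
    (hω : ∀ i, 0 ≤ ω i) (hsum : 0 < ∑ i, ω i) :
    ∀ a μL : Fin (n + 1) → ℝ,
      a = (∑ i, ω i • x i) →
      μL = (Real.sqrt K / Real.sqrt (-(lorentzInner a a))) • a →
      (lorentzInner μL μL = -K ∧ 0 < μL 0) ∧
      (∀ μ : Fin (n + 1) → ℝ, lorentzInner μ μ = -K → 0 < μ 0 → μ ≠ μL →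
        ∑ i, ω i * lorentzDistSq K (x i) μL < ∑ i, ω i * lorentzDistSq K (x i) μ) := by
  rintro a μL ha hμL
  have haa : lorentzInner a a < 0 := by
    rw [ha]
    exact lorentzInner_sum_smul_self_neg (fun i _ => hω i) hsum
      (fun i _ => by linarith [hx i]) (fun i _ => hx0 i)
  have ha0 : 0 < a 0 := by
    have h := sum_mul_pos_of_sum_pos (fun i _ => hω i) hsum (fun i _ => hx0 i)
    simpa [ha, Finset.sum_apply] using h
  set c := Real.sqrt K / Real.sqrt (-(lorentzInner a a)) with hc
  have hc0 : 0 < c := div_pos (Real.sqrt_pos.2 hK) (Real.sqrt_pos.2 (by linarith))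
  have hc2 : c * (c * lorentzInner a a) = -K := by
    rw [← mul_assoc, ← pow_two, hc, div_pow, Real.sq_sqrt hK.le, Real.sq_sqrt (by linarith)]
    have := haa.ne
    field_simp
  have hμLn : lorentzInner μL μL = -K := by
    rw [hμL, lorentzInner_smul_left, lorentzInner_comm, lorentzInner_smul_left, hc2]
  have hμL0 : 0 < μL 0 := by
    rw [hμL]
    exact mul_pos hc0 ha0
  refine ⟨⟨hμLn, hμL0⟩, fun μ hμ hμ0 hne => ?_⟩
  have hlt : lorentzInner μL μ < lorentzInner μL μL :=
    hμLn ▸ lorentzInner_lt_neg_of_ne hK hμLn hμ hμL0 hμ0 hne.symm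
  have hlin : ∀ y, lorentzInner μL y = c * lorentzInner a y := fun y => by
    rw [hμL, lorentzInner_smul_left]
  rw [hlin, hlin] at hlt
  rw [sum_mul_lorentzDistSq, sum_mul_lorentzDistSq, ← ha]
  linarith [lt_of_mul_lt_mul_left hlt hc0.le]
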